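/- Let D be a graph database over Σ, let 𝔾₁ and 𝔾₂ be basic graph patterns, and let S be the largest dual simulation between G(𝔾₁) and D. Then for every μ ∈ ⟦𝔾₁ OPT 𝔾₂⟧_D and every variable v ∈ vars(𝔾₁), it holds that (v, μ(v)) ∈ S. -/

import Mathlib

/-- A relation `S ⊆ V₁ × V₂` is a dual simulation between the edge-labeled directed
graphs `(V₁, E₁)` and `(V₂, E₂)` over the same label alphabet `L`. -/
def DualSim {V₁ V₂ L : Type*} (E₁ : Set (V₁ × L × V₁)) (E₂ : Set (V₂ × L × V₂))
    (S : Set (V₁ × V₂)) : Prop :=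
  ∀ v₁ v₂, (v₁, v₂) ∈ S →
    (∀ a w₁, (v₁, a, w₁) ∈ E₁ → ∃ w₂, (v₂, a, w₂) ∈ E₂ ∧ (w₁, w₂) ∈ S) ∧
    (∀ a u₁, (u₁, a, v₁) ∈ E₁ → ∃ u₂, (u₂, a, v₂) ∈ E₂ ∧ (u₁, u₂) ∈ S)

/-- The set of variables occurring in the triple patterns of a basic graph pattern. -/
def varsOf {𝒱 L : Type*} (G : Set (𝒱 × L × 𝒱)) : Set 𝒱 :=
  {v | ∃ a w, (v, a, w) ∈ G ∨ (w, a, v) ∈ G}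

/-- `μ` (a partial function, encoded via `Option`) is a match for the basic graph
pattern `G` in the graph database with edge relation `ED`: its domain is exactly
`varsOf G` and every triple pattern of `G` is realized as an edge of the database. -/
def IsMatch {𝒱 O L : Type*} (ED : Set (O × L × O)) (G : Set (𝒱 × L × 𝒱))
    (μ : 𝒱 → Option O) : Prop :=
  (∀ v, (∃ o, μ v = some o) ↔ v ∈ varsOf G) ∧
  ∀ v a w, (v, a, w) ∈ G → ∃ o o', μ v = some o ∧ μ w = some o' ∧ (o, a, o') ∈ ED

/-- The match `μ` viewed as a relation `{(v, μ(v)) | v ∈ dom(μ)}`. -/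
def matchRel {𝒱 O : Type*} (μ : 𝒱 → Option O) : Set (𝒱 × O) :=
  {p | μ p.1 = some p.2}

/-- Two partial functions are compatible iff they agree on their common domain. -/
def Compatible {𝒱 O : Type*} (μ₁ μ₂ : 𝒱 → Option O) : Prop :=
  ∀ v o₁ o₂, μ₁ v = some o₁ → μ₂ v = some o₂ → o₁ = o₂

/-- Union of two partial functions (left-biased; on compatible ones this is the union). -/
def munion {𝒱 O : Type*} (μ₁ μ₂ : 𝒱 → Option O) : 𝒱 → Option O :=
  fun v => (μ₁ v).orElse (fun _ => μ₂ v)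

/-- Restriction of a partial function to a set of variables. -/
noncomputable def restrictDom {𝒱 O : Type*} (μ : 𝒱 → Option O) (A : Set 𝒱) :
    𝒱 → Option O :=
  fun v => letI := Classical.dec (v ∈ A); if v ∈ A then μ v else none

/-- SPARQL conjunction (AND) semantics: compatible unions of matches. -/
def AndSem {𝒱 O L : Type*} (ED : Set (O × L × O)) (G₁ G₂ : Set (𝒱 × L × 𝒱)) :
    Set (𝒱 → Option O) :=
  {μ | ∃ μ₁ μ₂, IsMatch ED G₁ μ₁ ∧ IsMatch ED G₂ μ₂ ∧ Compatible μ₁ μ₂ ∧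
    μ = munion μ₁ μ₂}

/-- SPARQL optional (OPT) semantics: left-outer join. -/
def OptSem {𝒱 O L : Type*} (ED : Set (O × L × O)) (G₁ G₂ : Set (𝒱 × L × 𝒱)) :
    Set (𝒱 → Option O) :=
  AndSem ED G₁ G₂ ∪
    {μ | IsMatch ED G₁ μ ∧ ∀ μ', IsMatch ED G₂ μ' → ¬ Compatible μ μ'}

/-- The relation induced by a match of `G` is a dual simulation between `G` and the database. -/
theorem IsMatch.dualSim_matchRel {𝒱 O L : Type*} {ED : Set (O × L × O)}
    {G : Set (𝒱 × L × 𝒱)} {μ : 𝒱 → Option O} (h : IsMatch ED G μ) :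
    DualSim G ED (matchRel μ) := by
  intro v o hv
  refine ⟨fun a w hw => ?_, fun a u hu => ?_⟩
  · obtain ⟨o₁, o₂, h₁, h₂, hE⟩ := h.2 v a w hw
    obtain rfl : o₁ = o := Option.some.inj (h₁.symm.trans hv)
    exact ⟨o₂, hE, h₂⟩
  · obtain ⟨o₁, o₂, h₁, h₂, hE⟩ := h.2 u a v hu
    obtain rfl : o₂ = o := Option.some.inj (h₂.symm.trans hv)
    exact ⟨o₁, hE, h₁⟩

/-- Every result of `G₁ OPT G₂` extends a match of `G₁`. -/
theorem exists_isMatch_of_mem_optSem {𝒱 O L : Type*} {ED : Set (O × L × O)}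
    {G₁ G₂ : Set (𝒱 × L × 𝒱)} {μ : 𝒱 → Option O} (hμ : μ ∈ OptSem ED G₁ G₂) :
    ∃ μ₁, IsMatch ED G₁ μ₁ ∧ ∀ v o, μ₁ v = some o → μ v = some o := by
  rcases hμ with ⟨μ₁, μ₂, h₁, -, -, rfl⟩ | ⟨h, -⟩
  · exact ⟨μ₁, h₁, fun v o hv => by simp [munion, hv]⟩
  · exact ⟨μ, h, fun _ _ => id⟩

/-- Soundness for optional patterns: the assignments that any result of
`𝔾₁ OPT 𝔾₂` makes on the variables of `𝔾₁` are contained in the largest dual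
simulation between `G(𝔾₁)` and the database. -/
theorem optSem_soundness {𝒱 O L : Type*} (ED : Set (O × L × O))
    (G₁ G₂ : Set (𝒱 × L × 𝒱)) (h₁ : G₁.Finite) (h₂ : G₂.Finite)
    (S : Set (𝒱 × O)) (hS : DualSim G₁ ED S)
    (hmax : ∀ S', DualSim G₁ ED S' → S' ⊆ S)
    (μ : 𝒱 → Option O) (hμ : μ ∈ OptSem ED G₁ G₂)
    (v : 𝒱) (hv : v ∈ varsOf G₁) :
    ∃ o : O, μ v = some o ∧ (v, o) ∈ S := by
  obtain ⟨μ₁, h, hext⟩ := exists_isMatch_of_mem_optSem hμ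
  obtain ⟨o, ho⟩ := (h.1 v).2 hv
  exact ⟨o, hext v o ho, hmax _ h.dualSim_matchRel ho⟩
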